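/- arXiv:2408.12591 — 2 statements merged into one kernel-verified Lean document; each statement's English description precedes it below -/
import Mathlib

section
/- Let a ground normal logic program over N atoms with R rules be given, with program matrix Q, interpretation I, and complementary interpretation vector w. Then for every rule i : Fin R, the quantity 1 - min 1 ((Q.mulVec (fun p => 1 - w p)) i) equals 1 if the body of rule i is satisfied by I (i.e. pos i ⊆ I and (neg i) ∩ I = ∅), and equals 0 otherwise. -/
open Matrix

/-- Interpretation vector: indicator of `I`. -/
noncomputable def interpVec {N : ℕ} (I : Finset (Fin N)) : Fin N → ℝ :=
  fun j => if j ∈ I then 1 else 0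

/-- Complementary interpretation vector. -/
noncomputable def compVec {N : ℕ} (I : Finset (Fin N)) : Fin N ⊕ Fin N → ℝ :=
  Sum.elim (interpVec I) (fun j => 1 - interpVec I j)

/-- Program matrix of a ground normal logic program (also used for constraints). -/
noncomputable def progMat {N R : ℕ} (pos neg : Fin R → Finset (Fin N)) :
    Matrix (Fin R) (Fin N ⊕ Fin N) ℝ :=
  fun i => Sum.elim (fun j => if j ∈ pos i then 1 else 0)
                    (fun j => if j ∈ neg i then 1 else 0)

/-- Head matrix of a ground normal logic program. -/
noncomputable def headMat {N R : ℕ} (h : Fin R → Fin N) : Matrix (Fin N) (Fin R) ℝ :=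
  fun j i => if h i = j then 1 else 0

/-- The body of rule `i` is satisfied by interpretation `I`. -/
def BodySat {N R : ℕ} (pos neg : Fin R → Finset (Fin N)) (I : Finset (Fin N))
    (i : Fin R) : Prop :=
  pos i ⊆ I ∧ neg i ∩ I = ∅

/-- `I` satisfies the Clark completion of the program. -/
def SatComp {N R : ℕ} (h : Fin R → Fin N) (pos neg : Fin R → Finset (Fin N))
    (I : Finset (Fin N)) : Prop :=
  ∀ j : Fin N, j ∈ I ↔ ∃ i : Fin R, h i = j ∧ BodySat pos neg I i

instance {N R : ℕ} {pos neg : Fin R → Finset (Fin N)} {I : Finset (Fin N)} {i : Fin R} :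
    Decidable (BodySat pos neg I i) :=
  inferInstanceAs (Decidable (_ ∧ _))

/-- Against the complemented interpretation, row `i` of the program matrix counts the
false literals in the body of rule `i`. -/
theorem progMat_mulVec_one_sub_compVec {N R : ℕ} (pos neg : Fin R → Finset (Fin N))
    (I : Finset (Fin N)) (i : Fin R) :
    (progMat pos neg).mulVec (fun p => 1 - compVec I p) i =
      (((pos i \ I).card + (neg i ∩ I).card : ℕ) : ℝ) := by
  have hpos : ∀ j, (if j ∈ pos i then (1 : ℝ) else 0) * (1 - if j ∈ I then 1 else 0) =
      if j ∈ pos i \ I then 1 else 0 := by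
    intro j
    by_cases h₁ : j ∈ pos i <;> by_cases h₂ : j ∈ I <;> simp [h₁, h₂]
  have hneg : ∀ j, (if j ∈ neg i then (1 : ℝ) else 0) * (1 - (1 - if j ∈ I then 1 else 0)) =
      if j ∈ neg i ∩ I then 1 else 0 := by
    intro j
    by_cases h₁ : j ∈ neg i <;> by_cases h₂ : j ∈ I <;> simp [h₁, h₂]
  simp only [Matrix.mulVec, dotProduct, Fintype.sum_sum_type, progMat, compVec, interpVec,
    Sum.elim_inl, Sum.elim_inr, hpos, hneg, Finset.sum_boole, Finset.filter_univ_mem,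
    Nat.cast_add]

/-- A rule body is satisfied exactly when it contains no false literal. -/
theorem bodySat_iff_card_eq_zero {N R : ℕ} (pos neg : Fin R → Finset (Fin N))
    (I : Finset (Fin N)) (i : Fin R) :
    BodySat pos neg I i ↔ (pos i \ I).card + (neg i ∩ I).card = 0 := by
  simp [BodySat, Finset.sdiff_eq_empty_iff_subset]

theorem stmt_3 {N R : ℕ} (pos neg : Fin R → Finset (Fin N)) (I : Finset (Fin N))
    (i : Fin R) :
    1 - min 1 ((progMat pos neg).mulVec (fun p => 1 - compVec I p) i) =
      if BodySat pos neg I i then 1 else 0 := by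
  rw [progMat_mulVec_one_sub_compVec]
  split_ifs with hb
  · simp [(bodySat_iff_card_eq_zero pos neg I i).1 hb]
  · rw [bodySat_iff_card_eq_zero] at hb
    rw [min_eq_left (Nat.one_le_cast.2 (Nat.one_le_iff_ne_zero.2 hb)), sub_self]
end

section
/- Let a ground normal logic program over N atoms with R rules be given, let I be an interpretation with interpretation vector v, complementary interpretation vector w, and body-truth vector z defined by z i = 1 - min 1 ((Q.mulVec (fun p => 1 - w p)) i). Let L : Finset (Fin N) be nonempty with indicator row ℓ and external support matrix ES, and set u = min 1 (ℓ ⬝ᵥ (fun j => 1 - v j) + ℓ ⬝ᵥ (ES.mulVec z)). Then u = 1 if the conjunctive loop formula of L holds in I (i.e. if L ⊆ I then some external support rule of L has its body satisfied by I), and u = 0 otherwise. -/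
open Matrix

/-- Body-truth vector `z`. -/
noncomputable def bodyVec {N R : ℕ} (pos neg : Fin R → Finset (Fin N))
    (I : Finset (Fin N)) : Fin R → ℝ :=
  fun i => 1 - min 1 ((progMat pos neg).mulVec (fun p => 1 - compVec I p) i)

/-- Indicator row of a set of atoms. -/
noncomputable def indRow {N : ℕ} (L : Finset (Fin N)) : Fin N → ℝ :=
  fun j => if j ∈ L then 1 else 0

/-- Rule `i` is an external support of `L`. -/
def ExtSupport {N R : ℕ} (h : Fin R → Fin N) (pos : Fin R → Finset (Fin N))
    (L : Finset (Fin N)) (i : Fin R) : Prop :=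
  h i ∈ L ∧ pos i ∩ L = ∅

instance {N R : ℕ} {h : Fin R → Fin N} {pos : Fin R → Finset (Fin N)}
    {L : Finset (Fin N)} {i : Fin R} : Decidable (ExtSupport h pos L i) :=
  inferInstanceAs (Decidable (_ ∧ _))

/-- External support matrix of `L`. -/
noncomputable def esMat {N R : ℕ} (h : Fin R → Fin N) (pos : Fin R → Finset (Fin N))
    (L : Finset (Fin N)) : Matrix (Fin N) (Fin R) ℝ :=
  fun j i => if h i = j ∧ ExtSupport h pos L i then 1 else 0

theorem min_one_natCast (n : ℕ) : min 1 (n : ℝ) = if n = 0 then 0 else 1 := by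
  split_ifs with hn
  · simp [hn]
  · exact min_eq_left (by exact_mod_cast Nat.one_le_iff_ne_zero.mpr hn)

theorem indRow_dotProduct {N : ℕ} (L : Finset (Fin N)) (f : Fin N → ℝ) :
    indRow L ⬝ᵥ f = ∑ j ∈ L, f j := by
  simp [indRow, dotProduct]

theorem indRow_dotProduct_one_sub_interpVec {N : ℕ} (L I : Finset (Fin N)) :
    indRow L ⬝ᵥ (fun j => 1 - interpVec I j) = ((L \ I).card : ℝ) := by
  rw [indRow_dotProduct, ← Finset.filter_notMem_eq_sdiff, Finset.natCast_card_filter]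
  refine Finset.sum_congr rfl fun j _ => ?_
  by_cases hj : j ∈ I <;> simp [interpVec, hj]

theorem indRow_dotProduct_interpVec {N : ℕ} (L I : Finset (Fin N)) :
    indRow L ⬝ᵥ interpVec I = ((L ∩ I).card : ℝ) := by
  rw [indRow_dotProduct, ← Finset.filter_mem_eq_inter, Finset.natCast_card_filter]
  rfl

theorem bodyVec_apply {N R : ℕ} (pos neg : Fin R → Finset (Fin N))
    (I : Finset (Fin N)) (i : Fin R) :
    bodyVec pos neg I i = if BodySat pos neg I i then 1 else 0 := by
  have hiff : (pos i \ I).card + (neg i ∩ I).card = 0 ↔ BodySat pos neg I i := by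
    simp only [Nat.add_eq_zero_iff, Finset.card_eq_zero, Finset.sdiff_eq_empty_iff_subset, BodySat]
  rw [bodyVec, progMat_mulVec_one_sub_compVec, min_one_natCast]
  simp only [hiff]
  split_ifs <;> simp

theorem indRow_dotProduct_esMat_mulVec_bodyVec {N R : ℕ} (h : Fin R → Fin N)
    (pos neg : Fin R → Finset (Fin N)) (I L : Finset (Fin N)) :
    indRow L ⬝ᵥ (esMat h pos L).mulVec (bodyVec pos neg I) =
      ((Finset.univ.filter fun i => ExtSupport h pos L i ∧ BodySat pos neg I i).card : ℝ) := by
  rw [indRow_dotProduct]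
  simp only [mulVec, dotProduct, Finset.natCast_card_filter]
  rw [Finset.sum_comm]
  refine Finset.sum_congr rfl fun i _ => ?_
  by_cases hs : ExtSupport h pos L i
  · simp [esMat, bodyVec_apply, hs, hs.1]
  · simp [esMat, hs]

theorem stmt_11 {N R : ℕ} (h : Fin R → Fin N) (pos neg : Fin R → Finset (Fin N))
    (I : Finset (Fin N)) (L : Finset (Fin N)) (hL : L.Nonempty) :
    min 1 (indRow L ⬝ᵥ (fun j => 1 - interpVec I j) +
        indRow L ⬝ᵥ (esMat h pos L).mulVec (bodyVec pos neg I)) =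
      if L ⊆ I → ∃ i : Fin R, ExtSupport h pos L i ∧ BodySat pos neg I i
      then 1 else 0 := by
  rw [indRow_dotProduct_one_sub_interpVec, indRow_dotProduct_esMat_mulVec_bodyVec,
    ← Nat.cast_add, min_one_natCast, ← ite_not]
  refine if_congr ?_ rfl rfl
  simp [Finset.filter_eq_empty_iff, imp_iff_not_or, -not_and, not_and_or]
end
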